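/- Let X₁, X₂, … be i.i.d. copies of a random vector X in ℝ^p with E[‖X‖³] < ∞, let b'' : ℝ → ℝ be a bounded, continuous, nonnegative function, β₀ ∈ ℝ^p, L a fixed real p×p matrix, and Φ := E[b''(Xᵀβ₀) X Xᵀ] positive definite. Let (β̂ₙ) be random vectors with β̂ₙ → β₀ in probability, and (Φ̂ₙ) random symmetric positive-definite p×p matrices with Φ̂ₙ → Φ in probability and λ_max(Φ̂ₙ⁻¹) ≤ C almost surely for a finite constant C. Assume that for each n the triples (Xᵢ, β̂ₙ, Φ̂ₙ), i = 1, …, n, are identically distributed. Then for every fixed β ∈ ℝ^p, (1/n) Σ_{j=1}^n (b''(Xⱼᵀβ̂ₙ))^{1/2} ‖LΦ̂ₙ⁻¹Xⱼ‖ · b''(Xⱼᵀβ) Xⱼ Xⱼᵀ → E[(b''(Xᵀβ₀))^{1/2} ‖LΦ⁻¹X‖ · b''(Xᵀβ) X Xᵀ] in probability (entrywise). -/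

import Mathlib

open MeasureTheory ProbabilityTheory Filter Matrix

noncomputable section

/-- Euclidean norm of a vector in `ℝ^p`. -/
def euclNorm {p : ℕ} (v : Fin p → ℝ) : ℝ := Real.sqrt (∑ i, v i ^ 2)

section ConvergenceInMeasure

open scoped Topology ENNReal

variable {Ω : Type*} [MeasurableSpace Ω] {μ : Measure Ω}

theorem tendstoInMeasure_pi {κ ι : Type*} [Fintype ι] {E : ι → Type*}
    [∀ i, PseudoEMetricSpace (E i)] {l : Filter κ} {f : κ → Ω → ∀ i, E i} {g : Ω → ∀ i, E i}
    (h : ∀ i, TendstoInMeasure μ (fun n ω => f n ω i) l (fun ω => g ω i)) :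
    TendstoInMeasure μ f l g := by
  intro ε hε
  have hsum : Tendsto (fun n => ∑ i, μ {ω | ε ≤ edist (f n ω i) (g ω i)}) l (𝓝 0) := by
    simpa using tendsto_finsetSum Finset.univ fun i _ => h i ε hε
  refine tendsto_of_tendsto_of_tendsto_of_le_of_le tendsto_const_nhds hsum
    (fun _ => zero_le) fun n => ?_
  refine (measure_mono fun ω hω => ?_).trans (measure_iUnion_fintype_le μ _)
  simpa [edist_pi_def, Finset.le_sup_iff hε] using hω

theorem MeasureTheory.TendstoInMeasure.prodMk {κ E F : Type*} [PseudoEMetricSpace E] [PseudoEMetricSpace F]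
    {l : Filter κ} {f : κ → Ω → E} {f' : κ → Ω → F} {g : Ω → E} {g' : Ω → F}
    (h : TendstoInMeasure μ f l g) (h' : TendstoInMeasure μ f' l g') :
    TendstoInMeasure μ (fun n ω => (f n ω, f' n ω)) l (fun ω => (g ω, g' ω)) := by
  intro ε hε
  have hsum := (h ε hε).add (h' ε hε)
  rw [add_zero] at hsum
  refine tendsto_of_tendsto_of_tendsto_of_le_of_le tendsto_const_nhds hsum
    (fun _ => zero_le) fun n => ?_
  refine (measure_mono fun ω hω => ?_).trans (measure_union_le _ _)
  simpa [Prod.edist_eq] using hω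

/-- Continuous mapping theorem for a random map that is continuous at the limit. -/
theorem MeasureTheory.TendstoInMeasure.comp_continuousAt [IsFiniteMeasure μ] {E F : Type*}
    [PseudoEMetricSpace E] [PseudoEMetricSpace F] {Z : ℕ → Ω → E} {z : E} {H : Ω → E → F}
    (hZ : TendstoInMeasure μ Z atTop (fun _ => z))
    (hmeas : ∀ n, AEStronglyMeasurable (fun ω => H ω (Z n ω)) μ)
    (hH : ∀ ω, ContinuousAt (H ω) z) :
    TendstoInMeasure μ (fun n ω => H ω (Z n ω)) atTop (fun ω => H ω z) := by
  refine (exists_seq_tendstoInMeasure_atTop_iff hmeas).2 fun ns hns => ?_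
  obtain ⟨ms, hms, hlim⟩ := (hZ.comp hns.tendsto_atTop).exists_seq_tendsto_ae
  refine ⟨ms, hms, ?_⟩
  filter_upwards [hlim] with ω hω
  exact (hH ω).tendsto.comp hω

/-- Dominated convergence in `L¹` for sequences converging in measure. -/
theorem tendsto_eLpNorm_one_of_dominated_of_tendstoInMeasure {E : Type*} [NormedAddCommGroup E]
    {F : ℕ → Ω → E} {f : Ω → E} {bound : Ω → ℝ}
    (hF : ∀ n, AEStronglyMeasurable (F n) μ) (hbound : Integrable bound μ)
    (hle : ∀ n, ∀ᵐ ω ∂μ, ‖F n ω‖ ≤ bound ω) (hlim : TendstoInMeasure μ F atTop f) :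
    Tendsto (fun n => eLpNorm (F n - f) 1 μ) atTop (𝓝 0) := by
  refine tendsto_of_subseq_tendsto fun ns hns => ?_
  obtain ⟨ms, -, hms⟩ := (hlim.comp hns).exists_seq_tendsto_ae
  refine ⟨ms, ?_⟩
  simp_rw [eLpNorm_one_eq_lintegral_enorm, Pi.sub_apply, ← ofReal_norm]
  exact tendsto_lintegral_norm_of_dominated_convergence (fun n => hF _) hbound.2
    (fun n => hle _) hms

end ConvergenceInMeasure

/-- The `L¹` norm of an average of identically distributed variables is at most that of one. -/
theorem eLpNorm_average_le {Ω : Type*} [MeasurableSpace Ω] {μ : Measure Ω} {Y : ℕ → Ω → ℝ} {n : ℕ}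
    (hmeas : ∀ k < n, AEStronglyMeasurable (Y k) μ)
    (hY : ∀ k < n, IdentDistrib (Y k) (Y 0) μ μ) :
    eLpNorm (fun ω => (1 / (n : ℝ)) * ∑ k ∈ Finset.range n, Y k ω) 1 μ ≤ eLpNorm (Y 0) 1 μ := by
  rcases Nat.eq_zero_or_pos n with rfl | hn
  · simp
  have hsum : eLpNorm (∑ k ∈ Finset.range n, Y k) 1 μ ≤ n * eLpNorm (Y 0) 1 μ := by
    refine (eLpNorm_sum_le (fun k hk => hmeas k (Finset.mem_range.1 hk)) le_rfl).trans ?_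
    rw [Finset.sum_congr rfl fun k hk => (hY k (Finset.mem_range.1 hk)).eLpNorm_eq 1]
    simp
  have hsmul : (fun ω => (1 / (n : ℝ)) * ∑ k ∈ Finset.range n, Y k ω)
      = (1 / (n : ℝ)) • ∑ k ∈ Finset.range n, Y k := by
    ext ω
    simp
  have hn' : (n : ENNReal) ≠ 0 := by exact_mod_cast hn.ne'
  have henorm : ‖(1 / (n : ℝ))‖ₑ = (n : ENNReal)⁻¹ := by
    rw [one_div, enorm_inv (by exact_mod_cast hn.ne')]
    simp
  rw [hsmul, eLpNorm_const_smul, henorm]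
  calc (n : ENNReal)⁻¹ * eLpNorm (∑ k ∈ Finset.range n, Y k) 1 μ
      ≤ (n : ENNReal)⁻¹ * (n * eLpNorm (Y 0) 1 μ) := by gcongr
    _ = eLpNorm (Y 0) 1 μ := by
      rw [← mul_assoc, ENNReal.inv_mul_cancel hn' (ENNReal.natCast_ne_top n), one_mul]

section EuclNorm

variable {p : ℕ}

theorem euclNorm_nonneg (v : Fin p → ℝ) : 0 ≤ euclNorm v := Real.sqrt_nonneg _

theorem continuous_euclNorm : Continuous (euclNorm : (Fin p → ℝ) → ℝ) := by
  unfold euclNorm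
  fun_prop

theorem abs_le_euclNorm (v : Fin p → ℝ) (i : Fin p) : |v i| ≤ euclNorm v :=
  Real.abs_le_sqrt (Finset.single_le_sum (f := fun i => v i ^ 2) (fun _ _ => sq_nonneg _)
    (Finset.mem_univ i))

theorem euclNorm_le_sum_abs (v : Fin p → ℝ) : euclNorm v ≤ ∑ i, |v i| := by
  refine Real.sqrt_le_iff.2 ⟨Finset.sum_nonneg fun _ _ => abs_nonneg _, ?_⟩
  simpa using Finset.sum_sq_le_sq_sum_of_nonneg (s := Finset.univ) (f := fun i => |v i|)
    fun _ _ => abs_nonneg _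

theorem euclNorm_mulVec_le (A : Matrix (Fin p) (Fin p) ℝ) (v : Fin p → ℝ) :
    euclNorm (A *ᵥ v) ≤ (∑ i, ∑ j, |A i j|) * euclNorm v := by
  refine (euclNorm_le_sum_abs _).trans ?_
  simp_rw [Finset.sum_mul, mulVec, dotProduct]
  refine Finset.sum_le_sum fun i _ => (Finset.abs_sum_le_sum_abs _ _).trans ?_
  refine Finset.sum_le_sum fun j _ => ?_
  rw [abs_mul]
  exact mul_le_mul_of_nonneg_left (abs_le_euclNorm v j) (abs_nonneg _)

end EuclNorm

/-- A positive semidefinite matrix bounded above by `C • 1` has entries bounded by `C`. -/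
theorem Matrix.PosSemidef.abs_apply_le {ι : Type*} [Fintype ι] [DecidableEq ι] {A : Matrix ι ι ℝ}
    {C : ℝ} (hA : A.PosSemidef) (hC : (C • (1 : Matrix ι ι ℝ) - A).PosSemidef) (i j : ι) :
    |A i j| ≤ C := by
  have hdiag : ∀ k, A k k ≤ C := fun k => by
    have := hC.diag_nonneg (i := k)
    simpa using this
  have hsymm : A j i = A i j := by simpa using hA.1.apply i j
  have hadd := hA.dotProduct_mulVec_nonneg (Pi.single i 1 + Pi.single j 1)
  have hsub := hA.dotProduct_mulVec_nonneg (Pi.single i 1 - Pi.single j 1)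
  simp [mulVec_add, mulVec_sub, add_dotProduct, sub_dotProduct, hsymm] at hadd hsub
  have hi := hdiag i
  have hj := hdiag j
  rw [abs_le]
  constructor <;> linarith

section Weighted

variable {p : ℕ}

/-- The `(i, j)` entry of the weighted information matrix of a single observation `x`, with
plug-in parameter `θ = (coefficient vector, information matrix)`. -/
def weightedEntry (b : ℝ → ℝ) (L : Matrix (Fin p) (Fin p) ℝ) (β : Fin p → ℝ) (i j : Fin p)
    (x : Fin p → ℝ) (θ : (Fin p → ℝ) × (Fin p → Fin p → ℝ)) : ℝ :=
  Real.sqrt (b (x ⬝ᵥ θ.1)) * euclNorm ((L * (Matrix.of θ.2)⁻¹).mulVec x)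
    * (b (x ⬝ᵥ β) * (x i * x j))

theorem measurable_weightedEntry {b : ℝ → ℝ} (hb : Continuous b) (L : Matrix (Fin p) (Fin p) ℝ)
    (β : Fin p → ℝ) (i j : Fin p) :
    Measurable fun q : (Fin p → ℝ) × (Fin p → ℝ) × (Fin p → Fin p → ℝ) =>
      weightedEntry b L β i j q.1 q.2 := by
  have hinv : ∀ k l, Measurable fun q : (Fin p → ℝ) × (Fin p → ℝ) × (Fin p → Fin p → ℝ) =>
      (Matrix.of q.2.2)⁻¹ k l := by
    intro k l
    have hof : Continuous fun q : (Fin p → ℝ) × (Fin p → ℝ) × (Fin p → Fin p → ℝ) =>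
      Matrix.of q.2.2 := continuous_snd.comp continuous_snd
    simp only [Matrix.inv_def, Ring.inverse_eq_inv', Matrix.smul_apply, smul_eq_mul]
    exact hof.matrix_det.measurable.inv.mul (hof.matrix_adjugate.matrix_elem k l).measurable
  have hvec : Measurable fun q : (Fin p → ℝ) × (Fin p → ℝ) × (Fin p → Fin p → ℝ) =>
      (L * (Matrix.of q.2.2)⁻¹).mulVec q.1 := by
    refine measurable_pi_lambda _ fun k => ?_
    simp only [Matrix.mulVec, dotProduct, Matrix.mul_apply]
    exact Finset.measurable_fun_sum _ fun l _ =>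
      (Finset.measurable_fun_sum _ fun m _ => (hinv m l).const_mul _).mul
        ((measurable_pi_apply l).comp measurable_fst)
  have hdot : Continuous fun q : (Fin p → ℝ) × (Fin p → ℝ) × (Fin p → Fin p → ℝ) =>
      Real.sqrt (b (q.1 ⬝ᵥ q.2.1)) := by
    simp only [dotProduct]
    fun_prop
  have hpoly : Continuous fun q : (Fin p → ℝ) × (Fin p → ℝ) × (Fin p → Fin p → ℝ) =>
      b (q.1 ⬝ᵥ β) * (q.1 i * q.1 j) := by
    simp only [dotProduct]
    fun_prop
  exact (hdot.measurable.mul (continuous_euclNorm.measurable.comp hvec)).mul hpoly.measurable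

theorem continuousAt_weightedEntry {b : ℝ → ℝ} (hb : Continuous b)
    (L : Matrix (Fin p) (Fin p) ℝ) (β : Fin p → ℝ) (i j : Fin p) (x : Fin p → ℝ)
    {θ : (Fin p → ℝ) × (Fin p → Fin p → ℝ)} (hθ : (Matrix.of θ.2).det ≠ 0) :
    ContinuousAt (weightedEntry b L β i j x) θ := by
  have hof : Continuous fun η : (Fin p → ℝ) × (Fin p → Fin p → ℝ) => Matrix.of η.2 :=
    continuous_snd
  have hinv : ContinuousAt (fun η : (Fin p → ℝ) × (Fin p → Fin p → ℝ) => (Matrix.of η.2)⁻¹) θ := by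
    simp only [Matrix.inv_def, Ring.inverse_eq_inv']
    exact (hof.matrix_det.continuousAt.inv₀ hθ).smul hof.matrix_adjugate.continuousAt
  have hvec : ContinuousAt (fun η : (Fin p → ℝ) × (Fin p → Fin p → ℝ) =>
      euclNorm ((L * (Matrix.of η.2)⁻¹).mulVec x)) θ := by
    have hcont : Continuous fun B : Matrix (Fin p) (Fin p) ℝ => euclNorm ((L * B).mulVec x) :=
      continuous_euclNorm.comp
        ((continuous_const.matrix_mul continuous_id).matrix_mulVec continuous_const)
    exact hcont.continuousAt.comp hinv
  have hdot : Continuous fun η : (Fin p → ℝ) × (Fin p → Fin p → ℝ) =>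
      Real.sqrt (b (x ⬝ᵥ η.1)) := by
    simp only [dotProduct]
    fun_prop
  exact (hdot.continuousAt.mul hvec).mul continuousAt_const

theorem abs_weightedEntry_le {b : ℝ → ℝ} {M K : ℝ} (hb : ∀ t, |b t| ≤ M)
    (L : Matrix (Fin p) (Fin p) ℝ) (β : Fin p → ℝ) (i j : Fin p) (x : Fin p → ℝ)
    {θ : (Fin p → ℝ) × (Fin p → Fin p → ℝ)} (hK : ∀ k l, |(Matrix.of θ.2)⁻¹ k l| ≤ K) :
    |weightedEntry b L β i j x θ|
      ≤ Real.sqrt M * (∑ k, ∑ _l : Fin p, ∑ m, |L k m| * K) * M * euclNorm x ^ 3 := by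
  have hM : 0 ≤ M := (abs_nonneg _).trans (hb 0)
  have hx := euclNorm_nonneg x
  have hsum : ∑ k, ∑ l, |(L * (Matrix.of θ.2)⁻¹) k l| ≤ ∑ k, ∑ _l : Fin p, ∑ m, |L k m| * K := by
    refine Finset.sum_le_sum fun k _ => Finset.sum_le_sum fun l _ => ?_
    rw [Matrix.mul_apply]
    refine (Finset.abs_sum_le_sum_abs _ _).trans (Finset.sum_le_sum fun m _ => ?_)
    rw [abs_mul]
    exact mul_le_mul_of_nonneg_left (hK m l) (abs_nonneg _)
  have hnorm : euclNorm ((L * (Matrix.of θ.2)⁻¹).mulVec x)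
      ≤ (∑ k, ∑ _l : Fin p, ∑ m, |L k m| * K) * euclNorm x :=
    (euclNorm_mulVec_le _ _).trans (mul_le_mul_of_nonneg_right hsum hx)
  have hsqrt : Real.sqrt (b (x ⬝ᵥ θ.1)) ≤ Real.sqrt M :=
    Real.sqrt_le_sqrt ((le_abs_self _).trans (hb _))
  rw [weightedEntry, abs_mul, abs_mul, abs_mul, abs_mul, abs_of_nonneg (Real.sqrt_nonneg _),
    abs_of_nonneg (euclNorm_nonneg _)]
  have hS := (euclNorm_nonneg _).trans hnorm
  calc _ ≤ Real.sqrt M * ((∑ k, ∑ _l : Fin p, ∑ m, |L k m| * K) * euclNorm x)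
        * (M * (euclNorm x * euclNorm x)) := by
        gcongr
        · exact euclNorm_nonneg _
        · exact hb _
        · exact abs_le_euclNorm x i
        · exact abs_le_euclNorm x j
    _ = _ := by ring

end Weighted

/-- with consistent pilot estimators `β̂ₙ` and `Φ̂ₙ` (symmetric
positive definite, `λ_max(Φ̂ₙ⁻¹) ≤ C` a.s., expressed by `C•I − Φ̂ₙ⁻¹` being PSD
since `Φ̂ₙ⁻¹` is symmetric), for every fixed `β`,
`(1/n)∑_{k<n} (b''(Xₖᵀβ̂ₙ))^{1/2}‖LΦ̂ₙ⁻¹Xₖ‖·b''(Xₖᵀβ)XₖXₖᵀ →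
E[(b''(Xᵀβ₀))^{1/2}‖LΦ⁻¹X‖·b''(Xᵀβ)XXᵀ]` in probability, entrywise. -/
theorem weighted_information_tendsto_in_measure
    {Ω : Type*} [MeasurableSpace Ω] (μ : Measure Ω) [IsProbabilityMeasure μ]
    {p : ℕ} (X : ℕ → Ω → Fin p → ℝ) (X₀ : Ω → Fin p → ℝ)
    (hmeas : ∀ i, Measurable (X i)) (hX₀ : Measurable X₀)
    (hindep : iIndepFun X μ)
    (hident : ∀ i, IdentDistrib (X i) X₀ μ μ)
    (hmom : Integrable (fun ω => euclNorm (X₀ ω) ^ 3) μ)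
    (b'' : ℝ → ℝ) (hb_cont : Continuous b'') (hb_bdd : ∃ M, ∀ t, |b'' t| ≤ M)
    (hb_nonneg : ∀ t, 0 ≤ b'' t)
    (β₀ : Fin p → ℝ) (L Φ : Matrix (Fin p) (Fin p) ℝ)
    (hΦint : ∀ i j, Integrable (fun ω => b'' (X₀ ω ⬝ᵥ β₀) * (X₀ ω i * X₀ ω j)) μ)
    (hΦ : Φ = Matrix.of fun i j => ∫ ω, b'' (X₀ ω ⬝ᵥ β₀) * (X₀ ω i * X₀ ω j) ∂μ)
    (hΦpd : Φ.PosDef)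
    (βh : ℕ → Ω → Fin p → ℝ) (hβmeas : ∀ n, Measurable (βh n))
    (hβto : TendstoInMeasure μ βh atTop (fun _ => β₀))
    (Φh : ℕ → Ω → Matrix (Fin p) (Fin p) ℝ)
    (hΦhmeas : ∀ n i j, Measurable (fun ω => Φh n ω i j))
    (C : ℝ)
    (hΦhpd : ∀ n, ∀ᵐ ω ∂μ, (Φh n ω).PosDef ∧
      (C • (1 : Matrix (Fin p) (Fin p) ℝ) - (Φh n ω)⁻¹).PosSemidef)
    (hΦhto : ∀ i j, TendstoInMeasure μ (fun n ω => Φh n ω i j) atTop (fun _ => Φ i j))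
    (htriple : ∀ n, ∀ i < n, ∀ j < n,
      IdentDistrib (γ := (Fin p → ℝ) × (Fin p → ℝ) × (Fin p → Fin p → ℝ))
        (fun ω => (X i ω, βh n ω, fun a b => Φh n ω a b))
        (fun ω => (X j ω, βh n ω, fun a b => Φh n ω a b)) μ μ) :
    ∀ β : Fin p → ℝ, ∀ i j, TendstoInMeasure μ
      (fun (n : ℕ) ω => (1 / (n : ℝ)) * ∑ k ∈ Finset.range n,
        Real.sqrt (b'' (X k ω ⬝ᵥ βh n ω)) * euclNorm ((L * (Φh n ω)⁻¹).mulVec (X k ω))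
          * (b'' (X k ω ⬝ᵥ β) * (X k ω i * X k ω j)))
      atTop
      (fun _ => ∫ ω, Real.sqrt (b'' (X₀ ω ⬝ᵥ β₀)) * euclNorm ((L * Φ⁻¹).mulVec (X₀ ω))
          * (b'' (X₀ ω ⬝ᵥ β) * (X₀ ω i * X₀ ω j)) ∂μ) := by
  intro β i j
  obtain ⟨M, hM⟩ := hb_bdd
  let H := weightedEntry b'' L β i j
  let θ₀ : (Fin p → ℝ) × (Fin p → Fin p → ℝ) := (β₀, Φ)
  let θh : ℕ → Ω → (Fin p → ℝ) × (Fin p → Fin p → ℝ) := fun n ω => (βh n ω, fun a b => Φh n ω a b)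
  have hH : Measurable fun q : (Fin p → ℝ) × (Fin p → ℝ) × (Fin p → Fin p → ℝ) => H q.1 q.2 :=
    measurable_weightedEntry hb_cont L β i j
  have hH₀ : Measurable fun x => H x θ₀ := hH.comp (measurable_id.prodMk measurable_const)
  have hθmeas : ∀ n, Measurable (θh n) := fun n => (hβmeas n).prodMk
    (measurable_pi_lambda _ fun a => measurable_pi_lambda _ fun c => hΦhmeas n a c)
  have hθto : TendstoInMeasure μ θh atTop (fun _ => θ₀) :=
    TendstoInMeasure.prodMk hβto
      (tendstoInMeasure_pi fun a => tendstoInMeasure_pi fun c => hΦhto a c)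
  have hHn : ∀ n k, Measurable fun ω => H (X k ω) (θh n ω) := fun n k =>
    hH.comp ((hmeas k).prodMk (hθmeas n))
  have hHk : ∀ k, Measurable fun ω => H (X k ω) θ₀ := fun k => hH₀.comp (hmeas k)
  have hmom' : Integrable (fun ω => euclNorm (X 0 ω) ^ 3) μ :=
    ((hident 0).comp (continuous_euclNorm.measurable.pow_const 3)).integrable_iff.2 hmom
  have hint : Integrable (fun ω => H (X 0 ω) θ₀) μ := by
    obtain ⟨K, hK⟩ : ∃ K, ∀ k l, |(Matrix.of θ₀.2)⁻¹ k l| ≤ K :=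
      ⟨∑ k, ∑ l, |(Matrix.of θ₀.2)⁻¹ k l|, fun k l =>
        (Finset.single_le_sum (f := fun l => |(Matrix.of θ₀.2)⁻¹ k l|)
          (fun _ _ => abs_nonneg _) (Finset.mem_univ l)).trans
        (Finset.single_le_sum (f := fun k => ∑ l, |(Matrix.of θ₀.2)⁻¹ k l|)
          (fun _ _ => Finset.sum_nonneg fun _ _ => abs_nonneg _) (Finset.mem_univ k))⟩
    exact (hmom'.const_mul _).mono' (hHk 0).aestronglyMeasurable
      (ae_of_all _ fun ω => abs_weightedEntry_le hM L β i j (X 0 ω) hK)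
  have hplug : Tendsto (fun n => eLpNorm ((fun ω => H (X 0 ω) (θh n ω)) - fun ω => H (X 0 ω) θ₀)
      1 μ) atTop (nhds 0) := by
    refine tendsto_eLpNorm_one_of_dominated_of_tendstoInMeasure
      (fun n => (hHn n 0).aestronglyMeasurable)
      (hmom'.const_mul (Real.sqrt M * (∑ k, ∑ _l : Fin p, ∑ m, |L k m| * C) * M)) (fun n => ?_)
      (hθto.comp_continuousAt (H := fun ω => H (X 0 ω))
        (fun n => (hHn n 0).aestronglyMeasurable) fun ω =>
          continuousAt_weightedEntry hb_cont L β i j (X 0 ω) hΦpd.det_pos.ne')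
    filter_upwards [hΦhpd n] with ω hω
    exact abs_weightedEntry_le hM L β i j (X 0 ω) (K := C)
      (hω.1.inv.posSemidef.abs_apply_le hω.2)
  have hlln : Tendsto (fun n : ℕ => eLpNorm (fun ω => (n : ℝ)⁻¹ •
      (∑ k ∈ Finset.range n, H (X k ω) θ₀) - μ[fun ω => H (X 0 ω) θ₀]) 1 μ) atTop (nhds 0) :=
    strong_law_Lp le_rfl ENNReal.one_ne_top (fun k ω => H (X k ω) θ₀)
      (memLp_one_iff_integrable.2 hint)
      (fun k l hkl => (hindep.indepFun hkl).comp hH₀ hH₀)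
      (fun k => ((hident k).trans (hident 0).symm).comp hH₀)
  have hmean : μ[fun ω => H (X 0 ω) θ₀] = ∫ ω, H (X₀ ω) θ₀ ∂μ :=
    ((hident 0).comp hH₀).integral_eq
  rw [hmean] at hlln
  change TendstoInMeasure μ (fun (n : ℕ) ω => (1 / (n : ℝ)) * ∑ k ∈ Finset.range n,
    H (X k ω) (θh n ω)) atTop (fun _ => ∫ ω, H (X₀ ω) θ₀ ∂μ)
  refine tendstoInMeasure_of_tendsto_eLpNorm one_ne_zero
    (fun n => ((Finset.measurable_fun_sum _ fun k _ => hHn n k).const_mul _).aestronglyMeasurable)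
    aestronglyMeasurable_const ?_
  have hsum := hplug.add hlln
  rw [add_zero] at hsum
  refine tendsto_of_tendsto_of_tendsto_of_le_of_le tendsto_const_nhds hsum
    (fun _ => zero_le) fun n => ?_
  have hsplit : ((fun ω => (1 / (n : ℝ)) * ∑ k ∈ Finset.range n, H (X k ω) (θh n ω))
      - fun _ => ∫ ω, H (X₀ ω) θ₀ ∂μ)
      = (fun ω => (1 / (n : ℝ)) * ∑ k ∈ Finset.range n, (H (X k ω) (θh n ω) - H (X k ω) θ₀))
        + fun ω => (n : ℝ)⁻¹ • (∑ k ∈ Finset.range n, H (X k ω) θ₀) - ∫ ω, H (X₀ ω) θ₀ ∂μ := by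
    ext ω
    simp only [Pi.sub_apply, Pi.add_apply, Finset.sum_sub_distrib, smul_eq_mul]
    ring
  simp only [hsplit]
  refine (eLpNorm_add_le ?_ ?_ le_rfl).trans (add_le_add_left ?_ _)
  · exact ((Finset.measurable_fun_sum _ fun k _ =>
      (hHn n k).sub (hHk k)).const_mul _).aestronglyMeasurable
  · exact (((Finset.measurable_fun_sum _ fun k _ => hHk k).const_mul _).sub
      measurable_const).aestronglyMeasurable
  · exact eLpNorm_average_le (Y := fun k ω => H (X k ω) (θh n ω) - H (X k ω) θ₀)
      (fun k _ => ((hHn n k).sub (hHk k)).aestronglyMeasurable)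
      fun k hk => (htriple n k hk 0 (k.zero_le.trans_lt hk)).comp
        (hH.sub (hH₀.comp measurable_fst))
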